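/- arXiv:0812.2550 — 2 statements merged into one kernel-verified Lean document; each statement's English description precedes it below -/
import Mathlib

section
/- Let Γ = ⟨1, √2, e, √2·e⟩ ⊂ ℝ. Then the group of nonzero real numbers λ with λΓ = Γ is isomorphic to ℤ/2 × ℤ, generated by −1 and 1 + √2. -/
/-- The multiplicative group of nonzero reals `λ` with `λΓ = Γ`, as a subgroup of `ℝˣ`. -/
def autMul (Γ : AddSubgroup ℝ) : Subgroup ℝˣ where
  carrier := {u : ℝˣ | (fun x => (u : ℝ) * x) '' (Γ : Set ℝ) = (Γ : Set ℝ)}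
  one_mem' := by simp
  mul_mem' := by
    intro a b ha hb
    simp only [Set.mem_setOf_eq] at *
    have h : (fun x => ((a * b : ℝˣ) : ℝ) * x) = (fun x => (a : ℝ) * x) ∘ fun x => (b : ℝ) * x := by
      funext x; simp [mul_assoc]
    rw [h, Set.image_comp, hb, ha]
  inv_mem' := by
    intro a ha
    simp only [Set.mem_setOf_eq] at *
    conv_lhs => rw [← ha]
    rw [← Set.image_comp]
    have h : ((fun x => ((a⁻¹ : ℝˣ) : ℝ) * x) ∘ fun x => (a : ℝ) * x) = id := by
      funext x; simp
    rw [h, Set.image_id]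

/-- The subgroup `Γ = ⟨1, √2, e, √2·e⟩` of `ℝ`. -/
noncomputable def Γ10 : AddSubgroup ℝ :=
  AddSubgroup.closure {1, Real.sqrt 2, Real.exp 1, Real.sqrt 2 * Real.exp 1}

open Polynomial in
theorem e_transc : Transcendental ℤ (Real.exp 1) := by
  intro halg
  obtain ⟨q, hq0, hq⟩ := halg.exists_nonzero_coeff_and_aeval_eq_zero
    (mem_nonZeroDivisors_of_ne_zero (Real.exp_ne_zero 1))
  set d := q.natDegree with hd
  let f : ℤ[X] := ∏ i ∈ Finset.range d, (X - C ((i : ℤ) + 1))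
  have hfm : f.Monic := monic_prod_of_monic _ _ fun i _ => monic_X_sub_C _
  have hf0 : f.eval 0 ≠ 0 := by
    simp only [f, eval_prod, Finset.prod_ne_zero_iff]
    intro i _
    simp
    omega
  have hroot : ∀ k ∈ Finset.range d, ((k : ℂ) + 1) ∈ f.aroots ℂ := by
    intro k hk
    rw [mem_aroots]
    refine ⟨hfm.ne_zero, ?_⟩
    simp only [f, map_prod]
    apply Finset.prod_eq_zero hk
    simp
  obtain ⟨c, hc⟩ := LindemannWeierstrass.exp_polynomial_approx f hf0
  have hqC : ∑ k ∈ Finset.range (d+1), (q.coeff k : ℂ) * Complex.exp k = 0 := by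
    rw [aeval_eq_sum_range] at hq
    have := congrArg (fun x : ℝ => (x : ℂ)) hq
    simp only [zsmul_eq_mul] at this
    push_cast at this
    rw [← this]
    apply Finset.sum_congr rfl
    intro k _
    rw [← Complex.exp_nat_mul]; simp
  rw [Finset.sum_range_succ'] at hqC
  set A : ℝ := ∑ k ∈ Finset.range d, |(q.coeff (k+1) : ℝ)| with hA
  have hlim : Filter.Tendsto (fun p : ℕ => A * (c * (c ^ (p - 1) / ((p - 1).factorial : ℝ))))
      Filter.atTop (nhds 0) := by
    have h1 := (FloorSemiring.tendsto_pow_div_factorial_atTop c).comp (Filter.tendsto_sub_atTop_nat 1)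
    have := (h1.const_mul c).const_mul A
    simpa using this
  have hev := hlim.eventually (gt_mem_nhds (show (0:ℝ) < 1 by norm_num))
  obtain ⟨M, hM⟩ := Filter.eventually_atTop.1 hev
  obtain ⟨p, hpM, hp⟩ := Nat.exists_infinite_primes (M + (eval 0 f).natAbs + (q.coeff 0).natAbs + 1)
  obtain ⟨n, hn, g, -, hg⟩ := hc p (by omega) hp
  let Z : ℤ := n * q.coeff 0 + p * ∑ k ∈ Finset.range d, q.coeff (k+1) * g.eval ((k:ℤ)+1)
  have hZ : Z ≠ 0 := by
    intro h
    have h1 : (p : ℤ) ∣ n * q.coeff 0 := by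
      refine (Int.dvd_add_left (dvd_mul_right (p:ℤ) _)).1 (h ▸ dvd_zero _)
    rcases (Nat.prime_iff_prime_int.1 hp).dvd_or_dvd h1 with h2 | h2
    · exact hn h2
    · have := Nat.le_of_dvd (Int.natAbs_pos.2 hq0) (Int.natCast_dvd.1 h2)
      omega
  have hZ1 : (1 : ℝ) ≤ ‖(Z : ℂ)‖ := by
    rw [Complex.norm_intCast]
    exact_mod_cast Int.one_le_abs hZ
  have hZe : (Z : ℂ) = - ∑ k ∈ Finset.range d, (q.coeff (k+1) : ℂ) *
      (n • Complex.exp ((k:ℂ)+1) - p • aeval ((k:ℂ)+1) g) := by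
    have hag : ∀ k : ℕ, aeval ((k:ℂ)+1) g = ((g.eval ((k:ℤ)+1) : ℤ) : ℂ) := by
      intro k
      have := aeval_algebraMap_apply_eq_algebraMap_eval (A := ℂ) ((k:ℤ)+1) g
      simpa using this
    simp only [hag, Z, zsmul_eq_mul, nsmul_eq_mul, mul_sub, Finset.sum_sub_distrib]
    push_cast at hqC ⊢
    simp only [Complex.exp_zero, mul_one] at hqC
    have e1 : ∑ k ∈ Finset.range d, (q.coeff (k+1) : ℂ) * ((n:ℂ) * Complex.exp ((k:ℂ)+1))
      = n * ∑ k ∈ Finset.range d, (q.coeff (k+1) : ℂ) * Complex.exp ((k:ℂ)+1) := by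
      rw [Finset.mul_sum]; exact Finset.sum_congr rfl fun _ _ => by ring
    have e2 : ∑ k ∈ Finset.range d, (q.coeff (k+1) : ℂ) * ((p:ℂ) * (g.eval ((k:ℤ)+1) : ℤ))
      = p * ∑ k ∈ Finset.range d, (q.coeff (k+1) : ℂ) * (g.eval ((k:ℤ)+1) : ℤ) := by
      rw [Finset.mul_sum]; exact Finset.sum_congr rfl fun _ _ => by ring
    rw [e1, e2]
    linear_combination (n:ℂ) * hqC
  have hle : ‖(Z : ℂ)‖ ≤ A * (c ^ p / (p - 1).factorial) := by
    rw [hZe, norm_neg, hA, Finset.sum_mul]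
    refine (norm_sum_le _ _).trans (Finset.sum_le_sum fun k hk => ?_)
    rw [norm_mul, Complex.norm_intCast]
    exact mul_le_mul_of_nonneg_left (hg (hroot k hk)) (abs_nonneg _)
  have hlt := hM p (by omega)
  have : c ^ p = c * c ^ (p - 1) := by
    rw [← pow_succ', Nat.sub_add_cancel hp.one_le]
  rw [this, mul_div_assoc] at hle
  linarith

theorem quad_zero {a b c : ℝ} (ha : IsAlgebraic ℚ a) (hb : IsAlgebraic ℚ b) (hc : IsAlgebraic ℚ c)
    (h : a * Real.exp 1 ^ 2 + b * Real.exp 1 + c = 0) : a = 0 := by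
  by_contra hne
  have ht : Transcendental ℚ (Real.exp 1) := by
    have := e_transc
    rwa [Transcendental, IsFractionRing.isAlgebraic_iff ℤ ℚ ℝ] at this
  apply ht
  let S := algebraicClosure ℚ ℝ
  let a' : S := ⟨a, mem_algebraicClosure_iff.2 ha⟩
  let b' : S := ⟨b, mem_algebraicClosure_iff.2 hb⟩
  let c' : S := ⟨c, mem_algebraicClosure_iff.2 hc⟩
  have halg : IsAlgebraic S (Real.exp 1) := by
    refine ⟨Polynomial.C a' * Polynomial.X ^ 2 + Polynomial.C b' * Polynomial.X + Polynomial.C c',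
      ?_, ?_⟩
    · intro h0
      have := congrArg (fun p => Polynomial.coeff p 2) h0
      simp [Polynomial.coeff_X, Polynomial.coeff_C] at this
      exact hne (congrArg Subtype.val this)
    · simp only [map_add, map_mul, map_pow, Polynomial.aeval_C, Polynomial.aeval_X]
      exact h
  haveI : Algebra.IsAlgebraic ℚ S := algebraicClosure.isAlgebraic ℚ ℝ
  exact halg.restrictScalars ℚ

theorem mem_G (x : ℝ) : x ∈ Γ10 ↔ ∃ a b c d : ℤ,
    x = (a + b * Real.sqrt 2) + (c + d * Real.sqrt 2) * Real.exp 1 := by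
  constructor
  · intro h
    induction h using AddSubgroup.closure_induction with
    | mem x hx =>
      rcases hx with rfl | rfl | rfl | rfl
      · exact ⟨1, 0, 0, 0, by simp⟩
      · exact ⟨0, 1, 0, 0, by simp⟩
      · exact ⟨0, 0, 1, 0, by simp⟩
      · exact ⟨0, 0, 0, 1, by simp⟩
    | zero => exact ⟨0, 0, 0, 0, by simp⟩
    | add x y _ _ hx hy =>
      obtain ⟨a, b, c, d, rfl⟩ := hx
      obtain ⟨a', b', c', d', rfl⟩ := hy
      exact ⟨a + a', b + b', c + c', d + d', by push_cast; ring⟩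
    | neg x _ hx =>
      obtain ⟨a, b, c, d, rfl⟩ := hx
      exact ⟨-a, -b, -c, -d, by push_cast; ring⟩
  · rintro ⟨a, b, c, d, rfl⟩
    have h (y : ℝ) (hy : y ∈ ({1, Real.sqrt 2, Real.exp 1, Real.sqrt 2 * Real.exp 1} : Set ℝ))
        (n : ℤ) : (n : ℝ) * y ∈ Γ10 := by
      rw [← zsmul_eq_mul]
      exact zsmul_mem (AddSubgroup.subset_closure hy) n
    have := add_mem (add_mem (h 1 (by simp) a) (h (Real.sqrt 2) (by simp) b))
      (add_mem (h (Real.exp 1) (by simp) c) (h (Real.sqrt 2 * Real.exp 1) (by simp) d))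
    convert this using 1
    ring

theorem sq2 : Real.sqrt 2 * Real.sqrt 2 = 2 := Real.mul_self_sqrt (by norm_num)

theorem alg_zs (a b : ℤ) : IsAlgebraic ℚ ((a : ℝ) + b * Real.sqrt 2) := by
  have h2 : IsAlgebraic ℚ (Real.sqrt 2) := by
    refine IsAlgebraic.of_pow (n := 2) (by norm_num) ?_
    rw [Real.sq_sqrt (by norm_num)]
    exact_mod_cast isAlgebraic_intCast (R := ℚ) (A := ℝ) 2
  exact (isAlgebraic_intCast a).add ((isAlgebraic_intCast b).mul h2)

theorem zs_inj {a b c d : ℤ} (h : (a : ℝ) + b * Real.sqrt 2 = c + d * Real.sqrt 2) :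
    a = c ∧ b = d := by
  have hb : b = d := by
    by_contra hne
    have hne' : ((b : ℝ) - d) ≠ 0 := by
      rw [sub_ne_zero]; exact_mod_cast hne
    refine irrational_sqrt_two ⟨((c - a : ℤ) : ℚ) / ((b - d : ℤ) : ℚ), ?_⟩
    push_cast
    rw [div_eq_iff hne']
    linarith
  subst hb
  exact ⟨by exact_mod_cast (add_right_cancel h), rfl⟩

/-- Elements of the stabilizer lie in `ℤ[√2]`. -/
theorem stab_zs (u : ℝˣ) (hu : u ∈ autMul Γ10) : ∃ a b : ℤ, (u : ℝ) = a + b * Real.sqrt 2 := by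
  have hmul : ∀ x ∈ Γ10, (u : ℝ) * x ∈ Γ10 := by
    intro x hx
    have hu' : (fun x => (u : ℝ) * x) '' (Γ10 : Set ℝ) = (Γ10 : Set ℝ) := hu
    have : (u : ℝ) * x ∈ (Γ10 : Set ℝ) := by
      rw [← hu']; exact ⟨x, hx, rfl⟩
    exact this
  have h1 := hmul 1 ((mem_G 1).2 ⟨1, 0, 0, 0, by simp⟩)
  have h2 := hmul (Real.exp 1) ((mem_G _).2 ⟨0, 0, 1, 0, by simp⟩)
  rw [mul_one, mem_G] at h1
  rw [mem_G] at h2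
  obtain ⟨a, b, c, d, h1⟩ := h1
  obtain ⟨a', b', c', d', h2⟩ := h2
  have h0 : (c : ℝ) + d * Real.sqrt 2 = 0 := by
    refine quad_zero (b := ((a - c' : ℤ) : ℝ) + ((b - d' : ℤ) : ℝ) * Real.sqrt 2)
      (c := ((-a' : ℤ) : ℝ) + ((-b' : ℤ) : ℝ) * Real.sqrt 2) (alg_zs _ _) (alg_zs _ _)
      (alg_zs _ _) ?_
    push_cast
    rw [h1] at h2
    linear_combination h2
  exact ⟨a, b, by rw [h1, h0]; ring⟩

theorem stab_norm (u : ℝˣ) (hu : u ∈ autMul Γ10) : ∃ a b : ℤ, (u : ℝ) = a + b * Real.sqrt 2 ∧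
    (a ^ 2 - 2 * b ^ 2 = 1 ∨ a ^ 2 - 2 * b ^ 2 = -1) := by
  obtain ⟨a, b, h⟩ := stab_zs u hu
  obtain ⟨c, d, h'⟩ := stab_zs u⁻¹ (inv_mem hu)
  refine ⟨a, b, h, ?_⟩
  have h1 : (u : ℝ) * ((u⁻¹ : ℝˣ) : ℝ) = 1 := by simp
  rw [h, h'] at h1
  obtain ⟨e1, e2⟩ := zs_inj (a := a * c + 2 * b * d) (b := a * d + b * c) (c := 1) (d := 0) (by
    push_cast
    linear_combination h1 - b * d * sq2)
  apply Int.eq_one_or_neg_one_of_mul_eq_one (v := c ^ 2 - 2 * d ^ 2)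
  linear_combination (a * c + 2 * b * d + 1) * e1 - 2 * (a * d + b * c) * e2

theorem w_pos : (0 : ℝ) < 1 + Real.sqrt 2 := by positivity

theorem one_lt_w : (1 : ℝ) < 1 + Real.sqrt 2 := by
  have : (0:ℝ) < Real.sqrt 2 := by positivity
  linarith

/-- The unit `1 + √2`. -/
noncomputable def wU : ℝˣ := Units.mk0 (1 + Real.sqrt 2) w_pos.ne'

theorem mem_of (u : ℝˣ) (h1 : ∀ x ∈ Γ10, (u : ℝ) * x ∈ Γ10)
    (h2 : ∀ x ∈ Γ10, ((u⁻¹ : ℝˣ) : ℝ) * x ∈ Γ10) : u ∈ autMul Γ10 := by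
  show (fun x => (u : ℝ) * x) '' (Γ10 : Set ℝ) = (Γ10 : Set ℝ)
  ext x
  constructor
  · rintro ⟨y, hy, rfl⟩
    exact h1 y hy
  · intro hx
    exact ⟨_, h2 x hx, by simp⟩

theorem neg_one_mem_aut : (-1 : ℝˣ) ∈ autMul Γ10 := by
  apply mem_of <;> intro x hx <;> simpa using hx

theorem wU_mem : wU ∈ autMul Γ10 := by
  have hinv : ((wU⁻¹ : ℝˣ) : ℝ) = Real.sqrt 2 - 1 := by
    rw [Units.val_inv_eq_inv_val]
    show (1 + Real.sqrt 2)⁻¹ = _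
    apply inv_eq_of_mul_eq_one_right
    linear_combination sq2
  apply mem_of
  · intro x hx
    show (1 + Real.sqrt 2) * x ∈ Γ10
    rw [mem_G] at hx ⊢
    obtain ⟨a, b, c, d, rfl⟩ := hx
    refine ⟨a + 2 * b, a + b, c + 2 * d, c + d, ?_⟩
    push_cast
    linear_combination (b + d * Real.exp 1) * sq2
  · intro x hx
    rw [hinv]
    rw [mem_G] at hx ⊢
    obtain ⟨a, b, c, d, rfl⟩ := hx
    refine ⟨-a + 2 * b, a - b, -c + 2 * d, c - d, ?_⟩
    push_cast
    linear_combination (b + d * Real.exp 1) * sq2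

theorem small_eq_one (u : ℝˣ) (hu : u ∈ autMul Γ10) (h1 : 1 ≤ (u : ℝ))
    (h2 : (u : ℝ) < 1 + Real.sqrt 2) : (u : ℝ) = 1 := by
  obtain ⟨a, b, h, hn⟩ := stab_norm u hu
  have hs : Real.sqrt 2 < 1.5 := by
    rw [Real.sqrt_lt' (by norm_num)]; norm_num
  have hs1 : 1 < Real.sqrt 2 := by
    rw [Real.lt_sqrt (by norm_num)]; norm_num
  rw [h] at h1 h2 ⊢
  have hp : ((a : ℝ) + b * Real.sqrt 2) * (a - b * Real.sqrt 2) = ((a ^ 2 - 2 * b ^ 2 : ℤ) : ℝ) := by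
    push_cast
    linear_combination - (b:ℝ) ^ 2 * sq2
  have hc : |((a : ℝ) - b * Real.sqrt 2)| ≤ 1 := by
    have : |((a : ℝ) + b * Real.sqrt 2)| * |((a : ℝ) - b * Real.sqrt 2)| = 1 := by
      rw [← abs_mul, hp]
      rcases hn with hn | hn <;> simp [hn]
    rw [abs_of_nonneg (by linarith)] at this
    nlinarith [abs_nonneg ((a : ℝ) - b * Real.sqrt 2)]
  rw [abs_le] at hc
  have ha0 : 0 ≤ a := by
    have : (0 : ℝ) ≤ a := by linarith
    exact_mod_cast this
  have ha2 : a < 2 := by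
    have : (a : ℝ) < 2 := by linarith
    exact_mod_cast this
  have hb : b = 0 ∨ b = 1 ∨ b = -1 := by
    have hb2 : b ^ 2 ≤ 1 ^ 2 := by
      have : a ^ 2 ≤ 1 := by nlinarith
      rcases hn with hn | hn <;> omega
    have hb3 := abs_le.1 (abs_le_of_sq_le_sq hb2 (by norm_num))
    omega
  interval_cases a
  · exfalso; rcases hn with hn | hn <;> omega
  · rcases hb with rfl | rfl | rfl
    · simp
    · push_cast at h2; linarith
    · push_cast at h1; linarith

theorem pos_stab (u : ℝˣ) (hu : u ∈ autMul Γ10) (h0 : 0 < (u : ℝ)) : ∃ n : ℤ, u = wU ^ n := by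
  obtain ⟨n, hn1, hn2⟩ := exists_mem_Ico_zpow h0 one_lt_w
  refine ⟨n, ?_⟩
  have hwn : (0:ℝ) < (1 + Real.sqrt 2) ^ n := zpow_pos w_pos n
  have hval : ((u * (wU ^ n)⁻¹ : ℝˣ) : ℝ) = u / (1 + Real.sqrt 2) ^ n := by
    simp [wU, div_eq_mul_inv]
  have := small_eq_one (u * (wU ^ n)⁻¹) (mul_mem hu (inv_mem (zpow_mem wU_mem n)))
    (by rw [hval, le_div_iff₀ hwn]; simpa using hn1)
    (by rw [hval, div_lt_iff₀ hwn, mul_comm, ← zpow_add_one₀ w_pos.ne']; exact hn2)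
  exact mul_inv_eq_one.1 (Units.ext this)

theorem stab_iff (u : ℝˣ) : u ∈ autMul Γ10 ↔ ∃ n : ℤ, u = wU ^ n ∨ u = -1 * wU ^ n := by
  constructor
  · intro hu
    rcases lt_or_gt_of_ne u.ne_zero with h | h
    · obtain ⟨n, hn⟩ := pos_stab (-1 * u) (mul_mem neg_one_mem_aut hu) (by simpa using h)
      exact ⟨n, Or.inr (by rw [← hn]; simp)⟩
    · obtain ⟨n, hn⟩ := pos_stab u hu h
      exact ⟨n, Or.inl hn⟩
  · rintro ⟨n, rfl | rfl⟩
    · exact zpow_mem wU_mem n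
    · exact mul_mem neg_one_mem_aut (zpow_mem wU_mem n)

/-- `-1` as an element of the additive version of the stabilizer. -/
noncomputable def mA : Additive (autMul Γ10) := Additive.ofMul ⟨-1, neg_one_mem_aut⟩

/-- `1 + √2` as an element of the additive version of the stabilizer. -/
noncomputable def wA : Additive (autMul Γ10) := Additive.ofMul ⟨wU, wU_mem⟩

theorem two_mA : (2 : ℤ) • mA = 0 := by
  rw [two_zsmul]
  apply Additive.toMul.injective
  apply Subtype.ext
  show (-1 : ℝˣ) * -1 = 1
  simp

/-- The homomorphism `(ε, n) ↦ (-1)^ε (1 + √2)^n`. -/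
noncomputable def isoHom : ZMod 2 × ℤ →+ Additive (autMul Γ10) :=
  AddMonoidHom.coprod (ZMod.lift 2 ⟨zmultiplesHom _ mA, by
    simpa using two_mA⟩) (zmultiplesHom _ wA)

theorem isoHom_zero (n : ℤ) :
    (((Additive.toMul (isoHom (0, n)) : autMul Γ10) : ℝˣ)) = wU ^ n := by
  simp [isoHom, wA]

theorem isoHom_one (n : ℤ) :
    (((Additive.toMul (isoHom (1, n)) : autMul Γ10) : ℝˣ)) = -1 * wU ^ n := by
  have h : (ZMod.lift 2 ⟨zmultiplesHom _ mA, by simpa using two_mA⟩ : ZMod 2 →+ _) 1 = mA := by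
    have := ZMod.lift_coe 2 ⟨zmultiplesHom _ mA, by simpa using two_mA⟩ 1
    simpa using this
  simp only [isoHom, AddMonoidHom.coprod_apply, h]
  simp [wA, mA]

theorem wU_zpow_pos (n : ℤ) : (0 : ℝ) < ((wU ^ n : ℝˣ) : ℝ) := by
  rw [Units.val_zpow_eq_zpow_val]
  exact zpow_pos w_pos n

theorem isoHom_bij : Function.Bijective isoHom := by
  constructor
  · rw [injective_iff_map_eq_zero]
    rintro ⟨x, n⟩ h
    have h' : (((Additive.toMul (isoHom (x, n)) : autMul Γ10) : ℝˣ)) = 1 := by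
      rw [h]; rfl
    have hx : x = 0 ∨ x = 1 := by
      clear h h'
      revert x; decide
    rcases hx with rfl | rfl
    · rw [isoHom_zero] at h'
      have h2 := congrArg (fun u : ℝˣ => (u : ℝ)) h'
      simp only [Units.val_zpow_eq_zpow_val, Units.val_one] at h2
      have : n = 0 := (zpow_eq_one_iff_right₀ w_pos.le one_lt_w.ne').1 h2
      rw [this]; rfl
    · rw [isoHom_one] at h'
      have h2 := congrArg (fun u : ℝˣ => (u : ℝ)) h'
      have := wU_zpow_pos n
      simp only [Units.val_mul, Units.val_neg, Units.val_one] at h2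
      linarith
  · intro y
    obtain ⟨n, hn⟩ := (stab_iff _).1 (Additive.toMul y).2
    rcases hn with hn | hn
    · exact ⟨(0, n), Additive.toMul.injective (Subtype.ext ((isoHom_zero n).trans hn.symm))⟩
    · exact ⟨(1, n), Additive.toMul.injective (Subtype.ext ((isoHom_one n).trans hn.symm))⟩

/-- For `Γ = ⟨1, √2, e, √2·e⟩`, the group `{λ ≠ 0 : λΓ = Γ}` is isomorphic to
`ℤ/2 × ℤ` and consists exactly of the numbers `±(1 + √2)^n`, `n ∈ ℤ`. -/
theorem stmt_10 :
    {l : ℝ | l ≠ 0 ∧ (fun x => l * x) '' (Γ10 : Set ℝ) = (Γ10 : Set ℝ)} =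
      {l : ℝ | ∃ n : ℤ, l = (1 + Real.sqrt 2) ^ n ∨ l = -(1 + Real.sqrt 2) ^ n} ∧
    Nonempty (autMul Γ10 ≃* Multiplicative (ZMod 2 × ℤ)) := by
  constructor
  · ext l
    simp only [Set.mem_setOf_eq]
    constructor
    · rintro ⟨h0, hl⟩
      obtain ⟨n, hn⟩ := (stab_iff (Units.mk0 l h0)).1 hl
      refine ⟨n, hn.imp (fun h => ?_) (fun h => ?_)⟩
      · simpa [wU] using congrArg (fun u : ℝˣ => (u : ℝ)) h
      · simpa [wU] using congrArg (fun u : ℝˣ => (u : ℝ)) h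
    · rintro ⟨n, rfl | rfl⟩
      · have := (stab_iff (wU ^ n)).2 ⟨n, Or.inl rfl⟩
        refine ⟨(zpow_pos w_pos n).ne', ?_⟩
        have h : (fun x => ((wU ^ n : ℝˣ) : ℝ) * x) '' (Γ10 : Set ℝ) = (Γ10 : Set ℝ) := this
        simpa [wU] using h
      · have := (stab_iff (-1 * wU ^ n)).2 ⟨n, Or.inr rfl⟩
        refine ⟨neg_ne_zero.2 (zpow_pos w_pos n).ne', ?_⟩
        have h : (fun x => ((-1 * wU ^ n : ℝˣ) : ℝ) * x) '' (Γ10 : Set ℝ) = (Γ10 : Set ℝ) := this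
        simpa [wU] using h
  · exact ⟨(MulEquiv.ofBijective (M := Multiplicative (ZMod 2 × ℤ)) (N := autMul Γ10)
      (AddMonoidHom.toMultiplicativeLeft isoHom) isoHom_bij).symm⟩
end

section
/- Conversely, if α, β ∈ ℝ^n are Moebius-related by some A ∈ GL(n+1, ℤ) (with nonzero denominator) and Γ_α = ⟨e₁,...,e_n, α⟩ is dense in ℝ^n, then there exists a linear automorphism φ of ℝ^n with φ(Γ_α) = Γ_β, where Γ_β = ⟨e₁,...,e_n, β⟩. -/
/-- The projection of `ℝ^(n+1)` along the line spanned by `(1, α)`. -/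
def projAlong {n : ℕ} (α : Fin n → ℝ) : (Fin (n + 1) → ℝ) →ₗ[ℝ] (Fin n → ℝ) where
  toFun x := fun i => x i.succ - x 0 * α i
  map_add' x y := by ext i; simp; ring
  map_smul' c x := by ext i; simp; ring

/-- The embedding `x ↦ (0, x)`. -/
def embZero (n : ℕ) : (Fin n → ℝ) →ₗ[ℝ] (Fin (n + 1) → ℝ) where
  toFun x := Fin.cons 0 x
  map_add' x y := by ext i; refine Fin.cases ?_ (fun i => ?_) i <;> simp
  map_smul' c x := by ext i; refine Fin.cases ?_ (fun i => ?_) i <;> simp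

theorem projAlong_embZero {n : ℕ} (α x : Fin n → ℝ) :
    projAlong α (embZero n x) = x := by
  ext i; simp [projAlong, embZero]

theorem projAlong_self {n : ℕ} (α : Fin n → ℝ) :
    projAlong α (Fin.cons 1 α) = 0 := by
  ext i; simp [projAlong]

theorem embZero_projAlong {n : ℕ} (α : Fin n → ℝ) (x : Fin (n + 1) → ℝ) :
    embZero n (projAlong α x) = x - x 0 • (Fin.cons 1 α : Fin (n + 1) → ℝ) := by
  ext i; refine Fin.cases ?_ (fun i => ?_) i <;> simp [projAlong, embZero]

theorem proj_key {n : ℕ} (α β : Fin n → ℝ) (M : Matrix (Fin (n + 1)) (Fin (n + 1)) ℝ) (c : ℝ)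
    (h : Matrix.vecMul (Fin.cons 1 α) M = c • (Fin.cons 1 β : Fin (n + 1) → ℝ))
    (x : Fin (n + 1) → ℝ) :
    projAlong β (Matrix.vecMul (embZero n (projAlong α x)) M)
      = projAlong β (Matrix.vecMul x M) := by
  rw [embZero_projAlong, Matrix.sub_vecMul, Matrix.smul_vecMul, h, map_sub, map_smul, map_smul,
    projAlong_self]
  simp

theorem closure_eq_range {n : ℕ} (α : Fin n → ℝ) :
    ((AddSubgroup.closure
        (Set.range (fun i : Fin n => Pi.single i (1 : ℝ)) ∪ {α}) :
          AddSubgroup (Fin n → ℝ)) : Set (Fin n → ℝ)) =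
    Set.range (fun z : Fin (n + 1) → ℤ => projAlong α (fun i => (z i : ℝ))) := by
  apply Set.Subset.antisymm
  · intro x hx
    induction hx using AddSubgroup.closure_induction with
    | mem x hx =>
      rcases hx with ⟨i, rfl⟩ | rfl
      · refine ⟨Fin.cons 0 (Pi.single i 1), ?_⟩
        ext j
        by_cases h : j = i
        · subst h; simp [projAlong]
        · simp [projAlong, h]
      · refine ⟨Fin.cons (-1) 0, ?_⟩
        ext j
        simp [projAlong]
    | zero => exact ⟨0, by ext j; simp [projAlong]⟩
    | add x y _ _ hx hy =>
      obtain ⟨a, rfl⟩ := hx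
      obtain ⟨b, rfl⟩ := hy
      exact ⟨a + b, by ext j; simp [projAlong]; ring⟩
    | neg x _ hx =>
      obtain ⟨a, rfl⟩ := hx
      exact ⟨-a, by ext j; simp [projAlong]; ring⟩
  · rintro _ ⟨z, rfl⟩
    have h : projAlong α (fun i => (z i : ℝ)) =
        (∑ i : Fin n, z i.succ • (Pi.single i (1 : ℝ) : Fin n → ℝ)) - z 0 • α := by
      ext j
      simp [projAlong, Finset.sum_apply, Pi.single_apply]
    simp only [h]
    refine AddSubgroup.sub_mem _ (AddSubgroup.sum_mem _ fun i _ => ?_) ?_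
    · refine AddSubgroup.zsmul_mem _ (AddSubgroup.subset_closure ?_) _
      exact Or.inl ⟨i, rfl⟩
    · refine AddSubgroup.zsmul_mem _ (AddSubgroup.subset_closure ?_) _
      exact Or.inr rfl

theorem vecMul_cast {m : ℕ} (A : Matrix (Fin m) (Fin m) ℤ) (z : Fin m → ℤ) :
    Matrix.vecMul (fun i => (z i : ℝ)) (A.map (Int.cast : ℤ → ℝ))
      = fun i => ((Matrix.vecMul z A i : ℤ) : ℝ) := by
  ext i
  simp [Matrix.vecMul, dotProduct]

/-- Conversely, if `α, β ∈ ℝ^n` are Moebius-related by `A ∈ GL(n+1,ℤ)` (with nonzero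
denominator) and `Γ_α = ⟨e₁,...,e_n,α⟩` is dense, then some linear automorphism `φ`
of `ℝ^n` satisfies `φ(Γ_α) = Γ_β`. -/
theorem stmt_13 (n : ℕ) (α β : Fin n → ℝ)
    (A : Matrix (Fin (n + 1)) (Fin (n + 1)) ℤ) (hA : IsUnit A.det)
    (hden : ((A 0 0 : ℝ) + ∑ j, (A j.succ 0 : ℝ) * α j) ≠ 0)
    (hβ : ∀ i : Fin n, β i =
      ((A 0 i.succ : ℝ) + ∑ j, (A j.succ i.succ : ℝ) * α j) /
        ((A 0 0 : ℝ) + ∑ j, (A j.succ 0 : ℝ) * α j))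
    (hα : Dense ((AddSubgroup.closure
        (Set.range (fun i : Fin n => Pi.single i (1 : ℝ)) ∪ {α}) :
          AddSubgroup (Fin n → ℝ)) : Set (Fin n → ℝ))) :
    ∃ φ : (Fin n → ℝ) ≃ₗ[ℝ] (Fin n → ℝ),
      ⇑φ '' ((AddSubgroup.closure
          (Set.range (fun i : Fin n => Pi.single i (1 : ℝ)) ∪ {α}) :
            AddSubgroup (Fin n → ℝ)) : Set (Fin n → ℝ)) =
        ((AddSubgroup.closure
          (Set.range (fun i : Fin n => Pi.single i (1 : ℝ)) ∪ {β}) :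
            AddSubgroup (Fin n → ℝ)) : Set (Fin n → ℝ)) := by
  set d : ℝ := (A 0 0 : ℝ) + ∑ j, (A j.succ 0 : ℝ) * α j with hd
  set M : Matrix (Fin (n + 1)) (Fin (n + 1)) ℝ := A.map (Int.cast : ℤ → ℝ) with hM
  set N : Matrix (Fin (n + 1)) (Fin (n + 1)) ℝ := A⁻¹.map (Int.cast : ℤ → ℝ) with hN
  have hAB : A * A⁻¹ = 1 := Matrix.mul_nonsing_inv A hA
  have hBA : A⁻¹ * A = 1 := Matrix.nonsing_inv_mul A hA
  have hMN : M * N = 1 := by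
    have := congrArg (Int.castRingHom ℝ).mapMatrix hAB
    rw [map_mul, map_one] at this
    exact this
  have hNM : N * M = 1 := by
    have := congrArg (Int.castRingHom ℝ).mapMatrix hBA
    rw [map_mul, map_one] at this
    exact this
  have h1 : Matrix.vecMul (Fin.cons 1 α) M = d • (Fin.cons 1 β : Fin (n + 1) → ℝ) := by
    ext i
    refine Fin.cases ?_ (fun i => ?_) i
    · simp [Matrix.vecMul, dotProduct, Fin.sum_univ_succ, hM, hd, mul_comm]
    · have : d * β i = (A 0 i.succ : ℝ) + ∑ j, (A j.succ i.succ : ℝ) * α j := by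
        rw [hβ i]; field_simp
      simp [Matrix.vecMul, dotProduct, Fin.sum_univ_succ, hM, this, mul_comm]
  have h2 : Matrix.vecMul (Fin.cons 1 β) N = d⁻¹ • (Fin.cons 1 α : Fin (n + 1) → ℝ) := by
    have : (Fin.cons 1 β : Fin (n + 1) → ℝ) = d⁻¹ • Matrix.vecMul (Fin.cons 1 α) M := by
      rw [h1, smul_smul, inv_mul_cancel₀ hden, one_smul]
    rw [this, Matrix.smul_vecMul, Matrix.vecMul_vecMul, hMN, Matrix.vecMul_one]
  let f : (Fin n → ℝ) →ₗ[ℝ] (Fin n → ℝ) := projAlong β ∘ₗ M.vecMulLinear ∘ₗ embZero n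
  let g : (Fin n → ℝ) →ₗ[ℝ] (Fin n → ℝ) := projAlong α ∘ₗ N.vecMulLinear ∘ₗ embZero n
  have hf : ∀ x, f x = projAlong β (Matrix.vecMul (embZero n x) M) := fun x => rfl
  have hg : ∀ x, g x = projAlong α (Matrix.vecMul (embZero n x) N) := fun x => rfl
  have hfg : f ∘ₗ g = LinearMap.id := by
    apply LinearMap.ext; intro x
    rw [LinearMap.comp_apply, hf, hg, proj_key α β M d h1, Matrix.vecMul_vecMul, hNM,
      Matrix.vecMul_one, projAlong_embZero, LinearMap.id_apply]
  have hgf : g ∘ₗ f = LinearMap.id := by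
    apply LinearMap.ext; intro x
    rw [LinearMap.comp_apply, hf, hg, proj_key β α N d⁻¹ h2, Matrix.vecMul_vecMul, hMN,
      Matrix.vecMul_one, projAlong_embZero, LinearMap.id_apply]
  refine ⟨LinearEquiv.ofLinearMap f g hfg hgf, ?_⟩
  rw [closure_eq_range, closure_eq_range]
  have key : ∀ z : Fin (n + 1) → ℤ, f (projAlong α (fun i => (z i : ℝ)))
      = projAlong β (fun i => ((Matrix.vecMul z A i : ℤ) : ℝ)) := fun z => by
    rw [hf, proj_key α β M d h1, vecMul_cast]
  apply Set.Subset.antisymm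
  · rintro _ ⟨_, ⟨z, rfl⟩, rfl⟩
    exact ⟨Matrix.vecMul z A, (key z).symm⟩
  · rintro _ ⟨z, rfl⟩
    refine ⟨_, ⟨Matrix.vecMul z A⁻¹, rfl⟩, ?_⟩
    refine (key _).trans ?_
    rw [Matrix.vecMul_vecMul, hBA, Matrix.vecMul_one]
end
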